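/- Let X be a topological space and let φ, ψ be two flows on X. Assume that for every y ∈ X the negative reachable set O⁻(y) has nonempty interior, and that for every z ∈ X the positive reachable set O⁺(z) is dense in X. Then O⁺(z) = X for every z ∈ X. (The final step, Corollary 8.1 of Agrachev–Sachkov, used in the proof of Theorem 2.5 (ii) of the paper.) -/

import Mathlib

open Set

/-- One step of the switched system: apply flow `φ` (if the boolean is `true`)
or flow `ψ` (if it is `false`) for time `s`. -/
def flowStep {X : Type*} [TopologicalSpace X] (φ ψ : Flow ℝ X) (p : Bool × ℝ) (x : X) : X :=
  if p.1 then φ p.2 x else ψ p.2 x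

/-- The point obtained from `x` by successively applying the steps in the list `L`. -/
def flowChain {X : Type*} [TopologicalSpace X] (φ ψ : Flow ℝ X) :
    List (Bool × ℝ) → X → X
  | [], x => x
  | p :: L, x => flowChain φ ψ L (flowStep φ ψ p x)

/-- Points reachable from `z` by a nonempty sequence of steps whose times all satisfy `P`. -/
def flowReach {X : Type*} [TopologicalSpace X] (φ ψ : Flow ℝ X) (P : ℝ → Prop) (z : X) :
    Set X :=
  {y | ∃ L : List (Bool × ℝ), L ≠ [] ∧ (∀ p ∈ L, P p.2) ∧ y = flowChain φ ψ L z}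

/-- The orbit of `z` under the group generated by the two flows. -/
def flowOrbit {X : Type*} [TopologicalSpace X] (φ ψ : Flow ℝ X) (z : X) : Set X :=
  flowReach φ ψ (fun _ => True) z

/-- The positive reachable set of `z`: all times are positive. -/
def flowReachPos {X : Type*} [TopologicalSpace X] (φ ψ : Flow ℝ X) (z : X) : Set X :=
  flowReach φ ψ (fun t => 0 < t) z

/-- The negative reachable set of `z`: all times are negative. -/
def flowReachNeg {X : Type*} [TopologicalSpace X] (φ ψ : Flow ℝ X) (z : X) : Set X :=
  flowReach φ ψ (fun t => t < 0) z

/-- A point `z` is non-wandering for the flow `φ` if every neighborhood of `z` returns to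
itself at arbitrarily large times. -/
def IsNonWandering {X : Type*} [TopologicalSpace X] (φ : Flow ℝ X) (z : X) : Prop :=
  ∀ U ∈ nhds z, ∀ t > (0 : ℝ), ∃ tt > t, ((fun x => φ tt x) '' U ∩ U).Nonempty

theorem flowChain_append {X : Type*} [TopologicalSpace X] (φ ψ : Flow ℝ X)
    (L M : List (Bool × ℝ)) (x : X) :
    flowChain φ ψ (L ++ M) x = flowChain φ ψ M (flowChain φ ψ L x) := by
  induction L generalizing x with
  | nil => rfl
  | cons p L ih => exact ih _

theorem flowStep_neg_flowStep {X : Type*} [TopologicalSpace X] (φ ψ : Flow ℝ X)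
    (p : Bool × ℝ) (x : X) : flowStep φ ψ (p.1, -p.2) (flowStep φ ψ p x) = x := by
  unfold flowStep
  split <;> simp [← Flow.map_add]

/-- Running a chain backwards, in reverse order and with opposite times, undoes it. -/
theorem flowChain_reverse_neg {X : Type*} [TopologicalSpace X] (φ ψ : Flow ℝ X)
    (L : List (Bool × ℝ)) (x : X) :
    flowChain φ ψ (L.map fun p => (p.1, -p.2)).reverse (flowChain φ ψ L x) = x := by
  induction L generalizing x with
  | nil => rfl
  | cons p L ih =>
    simp only [List.map_cons, List.reverse_cons, flowChain_append, flowChain, ih]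
    exact flowStep_neg_flowStep φ ψ p x

theorem mem_flowReachPos_of_mem_flowReachNeg {X : Type*} [TopologicalSpace X]
    {φ ψ : Flow ℝ X} {w y : X} (h : w ∈ flowReachNeg φ ψ y) : y ∈ flowReachPos φ ψ w := by
  obtain ⟨L, hL, hneg, rfl⟩ := h
  refine ⟨(L.map fun p => (p.1, -p.2)).reverse, by simpa using hL, ?_,
    (flowChain_reverse_neg φ ψ L y).symm⟩
  intro p hp
  obtain ⟨q, hq, rfl⟩ := List.mem_map.1 (List.mem_reverse.1 hp)
  exact neg_pos.2 (hneg q hq)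

theorem flowReach_trans {X : Type*} [TopologicalSpace X] {φ ψ : Flow ℝ X} {P : ℝ → Prop}
    {x y z : X} (hxy : y ∈ flowReach φ ψ P x) (hyz : z ∈ flowReach φ ψ P y) :
    z ∈ flowReach φ ψ P x := by
  obtain ⟨L, hL, hLP, rfl⟩ := hxy
  obtain ⟨M, -, hMP, rfl⟩ := hyz
  refine ⟨L ++ M, by simp [hL], ?_, (flowChain_append φ ψ L M x).symm⟩
  intro p hp
  exact (List.mem_append.1 hp).elim (hLP p) (hMP p)

/-- Corollary 8.1 of Agrachev–Sachkov: if every negative reachable set has nonempty interior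
and every positive reachable set is dense, then every positive reachable set is the whole
space. -/
theorem reachPos_eq_univ_of_dense
    {X : Type*} [TopologicalSpace X] (φ ψ : Flow ℝ X)
    (hneg : ∀ y : X, (interior (flowReachNeg φ ψ y)).Nonempty)
    (hdense : ∀ z : X, Dense (flowReachPos φ ψ z)) :
    ∀ z : X, flowReachPos φ ψ z = univ := by
  intro z
  refine eq_univ_of_forall fun y => ?_
  obtain ⟨w, hw, hzw⟩ := (hdense z).inter_open_nonempty _ isOpen_interior (hneg y)
  exact flowReach_trans hzw (mem_flowReachPos_of_mem_flowReachNeg (interior_subset hw))
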